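/- Let (X,d,T) be a topological dynamical system with continuous Ξ: M(X) → Y, φ ∈ C(X,ℝ), and K' ⊂ Y a nonempty closed subset. Then P(G*_{K'}, φ) ≤ inf{Λ(y,φ) : y ∈ K'}, where G*_{K'} = {x ∈ X : A(Ξ L_n x) = K'} and Λ(y,φ) = sup{h(T,μ)+∫φ dμ : μ ∈ M(X,T), Ξμ = y} (−∞ if y ∉ Ξ(M(X,T))). -/

import Mathlib

open MeasureTheory Filter Topology Set
open scoped ENNReal

noncomputable section

/-- Birkhoff sum `S_m φ(x) = Σ_{i=0}^{m-1} φ(T^i x)`. -/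
def birkhoffS {X : Type*} (T : X → X) (φ : X → ℝ) (m : ℕ) (x : X) : ℝ :=
  ∑ i ∈ Finset.range m, φ (T^[i] x)

/-- Bowen ball `B_m(x,ε) = {y : max_{0 ≤ i < m} D(T^i x, T^i y) ≤ ε}`, with respect
to a distance function `D`. -/
def bowenBallD {X : Type*} (D : X → X → ℝ) (T : X → X) (x : X) (m : ℕ) (ε : ℝ) : Set X :=
  {y | ∀ i < m, D (T^[i] x) (T^[i] y) ≤ ε}

/-- `C` is an admissible (finite or countable) cover of `Z` by Bowen balls
`B_m(x,ε)` with `m ≥ n`. -/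
def covOK {X : Type*} (D : X → X → ℝ) (T : X → X) (Z : Set X) (n : ℕ) (ε : ℝ)
    (C : Set (X × ℕ)) : Prop :=
  C.Countable ∧ (∀ p ∈ C, n ≤ p.2) ∧ Z ⊆ ⋃ p ∈ C, bowenBallD D T p.1 p.2 ε

/-- `M(Z,t,φ,n,ε) = inf_C Σ exp(-t m + sup_{y ∈ B_m(x,ε)} S_m φ(y))`. -/
def Mpre {X : Type*} (D : X → X → ℝ) (T : X → X) (Z : Set X) (t : ℝ) (φ : X → ℝ)
    (n : ℕ) (ε : ℝ) : ℝ≥0∞ :=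
  ⨅ (C : Set (X × ℕ)) (_ : covOK D T Z n ε C),
    ∑' p : C, ENNReal.ofReal
      (Real.exp (-t * ((p : X × ℕ).2 : ℝ) +
        sSup (birkhoffS T φ (p : X × ℕ).2 '' bowenBallD D T (p : X × ℕ).1 (p : X × ℕ).2 ε)))

/-- `M(Z,t,φ,ε) = lim_n M(Z,t,φ,n,ε)` (the quantity is nondecreasing in `n`). -/
def Mlim {X : Type*} (D : X → X → ℝ) (T : X → X) (Z : Set X) (t : ℝ) (φ : X → ℝ)
    (ε : ℝ) : ℝ≥0∞ :=
  ⨆ n : ℕ, Mpre D T Z t φ n ε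

/-- `P(Z,φ,ε)`: the critical value of `t ↦ M(Z,t,φ,ε)`. -/
def pressAt {X : Type*} (D : X → X → ℝ) (T : X → X) (Z : Set X) (φ : X → ℝ)
    (ε : ℝ) : EReal :=
  sInf {s : EReal | ∃ t : ℝ, s = (t : EReal) ∧ Mlim D T Z t φ ε = 0}

/-- The Pesin–Pitskel topological pressure `P(Z,φ) = lim_{ε → 0⁺} P(Z,φ,ε)`
of an arbitrary subset `Z`, with respect to a distance function `D`. -/
def pressD {X : Type*} (D : X → X → ℝ) (T : X → X) (Z : Set X) (φ : X → ℝ) : EReal :=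
  limsup (fun ε : ℝ => pressAt D T Z φ ε) (𝓝[>] 0)

/-- Topological pressure of a subset of a metric space. -/
def pressure {X : Type*} [MetricSpace X] (T : X → X) (Z : Set X) (φ : X → ℝ) : EReal :=
  pressD (fun a b => dist a b) T Z φ

/-- `N(Z,t,ψ,n,ε) = inf_C Σ exp(-t · sup_{y ∈ B_m(x,ε)} S_m ψ(y))`
(the BS-dimension Carathéodory sum). -/
def Npre {X : Type*} (D : X → X → ℝ) (T : X → X) (Z : Set X) (t : ℝ) (ψ : X → ℝ)
    (n : ℕ) (ε : ℝ) : ℝ≥0∞ :=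
  ⨅ (C : Set (X × ℕ)) (_ : covOK D T Z n ε C),
    ∑' p : C, ENNReal.ofReal
      (Real.exp (-t *
        sSup (birkhoffS T ψ (p : X × ℕ).2 '' bowenBallD D T (p : X × ℕ).1 (p : X × ℕ).2 ε)))

/-- `BS(Z,ψ,ε)`: critical value of `t ↦ lim_n N(Z,t,ψ,n,ε)`. -/
def BSat {X : Type*} (D : X → X → ℝ) (T : X → X) (Z : Set X) (ψ : X → ℝ)
    (ε : ℝ) : EReal :=
  sInf {s : EReal | ∃ t : ℝ, s = (t : EReal) ∧ (⨆ n : ℕ, Npre D T Z t ψ n ε) = 0}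

/-- The BS-dimension `BS(Z,ψ) = lim_{ε → 0⁺} BS(Z,ψ,ε)` of Barreira–Schmeling. -/
def BSdimD {X : Type*} (D : X → X → ℝ) (T : X → X) (Z : Set X) (ψ : X → ℝ) : EReal :=
  limsup (fun ε : ℝ => BSat D T Z ψ ε) (𝓝[>] 0)

/-- BS-dimension in a metric space. -/
def BSdim {X : Type*} [MetricSpace X] (T : X → X) (Z : Set X) (ψ : X → ℝ) : EReal :=
  BSdimD (fun a b => dist a b) T Z ψ

end
open MeasureTheory Filter Topology Set
open scoped ENNReal

noncomputable section

/-- The `n`-th (here: `(n+1)`-st) empirical measure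
`L_{n+1} x = (1/(n+1)) Σ_{k=0}^{n} δ_{T^k x}` as a Borel probability measure. -/
noncomputable def empPM {X : Type*} [MeasurableSpace X] (T : X → X) (x : X) (n : ℕ) :
    ProbabilityMeasure X :=
  ⟨((n + 1 : ℝ≥0∞))⁻¹ • ∑ k ∈ Finset.range (n + 1), Measure.dirac (T^[k] x), by
    constructor
    rw [Measure.smul_apply, Measure.coe_finset_sum, Finset.sum_apply]
    simp only [measure_univ, Finset.sum_const, Finset.card_range, nsmul_eq_mul, mul_one]
    rw [smul_eq_mul]
    have h1 : ((n : ℝ≥0∞) + 1) ≠ 0 := by simp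
    have h2 : ((n : ℝ≥0∞) + 1) ≠ ⊤ := by simp [ENNReal.add_ne_top]
    rw [show ((n + 1 : ℕ) : ℝ≥0∞) = (n : ℝ≥0∞) + 1 by push_cast; ring]
    exact ENNReal.inv_mul_cancel h1 h2⟩

/-- The set of accumulation (cluster) points of a sequence. -/
def accPts {Y : Type*} [TopologicalSpace Y] (u : ℕ → Y) : Set Y :=
  {p | MapClusterPt p atTop u}

/-- `μ` is a `T`-invariant probability measure. -/
def InvMeas {X : Type*} [MeasurableSpace X] (T : X → X) (μ : ProbabilityMeasure X) : Prop :=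
  (μ : Measure X).map T = (μ : Measure X)

/-- Entropy `H_μ` of the refined partition `⋁_{j=0}^{m-1} T^{-j} P` determined by a
finite measurable partition coded by `P : X → Fin k`. -/
noncomputable def partitionH {X : Type*} [MeasurableSpace X] (T : X → X) (μ : Measure X)
    {k : ℕ} (P : X → Fin k) (m : ℕ) : ℝ :=
  ∑ s : Fin m → Fin k,
    Real.negMulLog ((μ {x | ∀ j : Fin m, P (T^[(j : ℕ)] x) = s j}).toReal)

/-- Kolmogorov–Sinai (measure-theoretic) entropy `h(T,μ)`: the supremum over finite
measurable partitions of `lim_n (1/n) H_μ(⋁_{j<n} T^{-j}P)`; by subadditivity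
(Fekete) the limit equals the infimum. -/
noncomputable def entropyKS {X : Type*} [MeasurableSpace X] (T : X → X) (μ : Measure X) :
    ℝ≥0∞ :=
  ⨆ (k : ℕ) (P : X → Fin k) (_ : Measurable P),
    ⨅ n : ℕ, ENNReal.ofReal (partitionH T μ P (n + 1) / (n + 1))

/-- `Λ(y,φ) = sup { h(T,μ) + ∫ φ dμ : μ ∈ M(X,T), Ξ μ = y }`, with value `⊥ = -∞`
when no invariant measure is mapped to `y` by `Ξ`. -/
noncomputable def Lam {X Y : Type*} [MeasurableSpace X] (T : X → X)
    (Ξ : ProbabilityMeasure X → Y) (φ : X → ℝ) (y : Y) : EReal :=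
  ⨆ (μ : ProbabilityMeasure X) (_ : InvMeas T μ ∧ Ξ μ = y),
    ((entropyKS T (μ : Measure X) : ℝ≥0∞) : EReal) + ((∫ x, φ x ∂(μ : Measure X) : ℝ) : EReal)

end

/-- Every finite probability vector admits a finite code-length function satisfying Kraft's
inequality whose mean length exceeds the entropy by at most `δ`. -/
theorem exists_cost_le_entropy_add {α : Type*} [Fintype α] (q : α → ℝ) (hq0 : ∀ a, 0 ≤ q a)
    (hq1 : ∑ a, q a = 1) {δ : ℝ} (hδ : 0 < δ) :
    ∃ c : α → ℝ, (∀ a, 0 ≤ c a) ∧ ∑ a, Real.exp (-c a) ≤ 1 ∧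
      ∑ a, q a * c a ≤ ∑ a, Real.negMulLog (q a) + δ := by
  have hne : Nonempty α := by
    by_contra h
    rw [not_nonempty_iff] at h
    simp at hq1
  have hcard : (0 : ℝ) < Fintype.card α := by exact_mod_cast Fintype.card_pos
  have hd0 : 0 < Real.exp (-δ) := Real.exp_pos _
  have hd1 : Real.exp (-δ) < 1 := by simpa using hδ
  set p : α → ℝ := fun a => Real.exp (-δ) * q a + (1 - Real.exp (-δ)) / Fintype.card α with hp
  have hlow : ∀ a, Real.exp (-δ) * q a ≤ p a := fun a =>
    le_add_of_nonneg_right (div_nonneg (by linarith) hcard.le)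
  have hp0 : ∀ a, 0 < p a := fun a =>
    add_pos_of_nonneg_of_pos (mul_nonneg hd0.le (hq0 a)) (div_pos (by linarith) hcard)
  have hp1 : ∑ a, p a = 1 := by
    simp only [hp, Finset.sum_add_distrib, ← Finset.mul_sum, hq1, Finset.sum_const,
      Finset.card_univ, nsmul_eq_mul]
    field_simp
    ring
  have hple : ∀ a, p a ≤ 1 := fun a =>
    hp1 ▸ Finset.single_le_sum (fun b _ => (hp0 b).le) (Finset.mem_univ a)
  refine ⟨fun a => -Real.log (p a), fun a => ?_, ?_, ?_⟩
  · exact neg_nonneg.2 (Real.log_nonpos (hp0 a).le (hple a))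
  · simp only [neg_neg, Real.exp_log (hp0 _), hp1, le_refl]
  · have key : ∀ a, q a * -Real.log (p a) ≤ Real.negMulLog (q a) + q a * δ := by
      intro a
      rcases (hq0 a).eq_or_lt with h | h
      · simp [← h]
      · have := Real.log_le_log (mul_pos hd0 h) (hlow a)
        rw [Real.log_mul hd0.ne' h.ne', Real.log_exp] at this
        rw [Real.negMulLog]
        nlinarith
    calc _ ≤ ∑ a, (Real.negMulLog (q a) + q a * δ) := Finset.sum_le_sum fun a _ => key a
      _ = _ := by rw [Finset.sum_add_distrib, ← Finset.sum_mul, hq1, one_mul]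

/-- A Chernoff-type count of the finite sequences of small total cost. -/
theorem card_filter_sum_le {α : Type*} [Fintype α] (c : α → ℝ)
    (hc : ∑ a, Real.exp (-c a) ≤ 1) (J : ℕ) (u : ℝ) :
    (((Finset.univ : Finset (Fin J → α)).filter fun b => ∑ j, c (b j) ≤ u).card : ℝ)
      ≤ Real.exp u := by
  classical
  have h0 : (0 : ℝ) ≤ ∑ a, Real.exp (-c a) := Finset.sum_nonneg fun a _ => (Real.exp_pos _).le
  calc (((Finset.univ : Finset (Fin J → α)).filter fun b => ∑ j, c (b j) ≤ u).card : ℝ)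
      = ∑ b ∈ (Finset.univ : Finset (Fin J → α)).filter fun b => ∑ j, c (b j) ≤ u, (1 : ℝ) := by
        simp
    _ ≤ ∑ b ∈ (Finset.univ : Finset (Fin J → α)).filter fun b => ∑ j, c (b j) ≤ u,
          Real.exp u * ∏ j, Real.exp (-c (b j)) := by
        refine Finset.sum_le_sum fun b hb => ?_
        rw [← Real.exp_sum, ← Real.exp_add, Real.one_le_exp_iff, Finset.sum_neg_distrib]
        linarith [(Finset.mem_filter.1 hb).2]
    _ ≤ ∑ b : Fin J → α, Real.exp u * ∏ j, Real.exp (-c (b j)) :=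
        Finset.sum_le_univ_sum_of_nonneg fun b => by positivity
    _ = Real.exp u * (∑ a, Real.exp (-c a)) ^ J := by
        rw [← Finset.mul_sum, Fintype.sum_pow]
    _ ≤ Real.exp u := mul_le_of_le_one_right (Real.exp_pos u).le (pow_le_one₀ h0 hc)

/-- A finite coding of `S` that refines the covering relation yields a finite cover. -/
theorem exists_finset_cover_of_code {X κ : Type*} (S : Set X) (B : X → Set X) (code : X → κ)
    (G : Finset κ) (hG : ∀ x ∈ S, code x ∈ G)
    (hB : ∀ x ∈ S, ∀ y ∈ S, code x = code y → y ∈ B x) :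
    ∃ E : Finset X, (∀ x ∈ E, x ∈ S) ∧ (∀ y ∈ S, ∃ x ∈ E, y ∈ B x) ∧ E.card ≤ G.card := by
  classical
  have hfin : (code '' S).Finite := G.finite_toSet.subset (by rintro _ ⟨x, hx, rfl⟩; exact hG x hx)
  have hrep : ∀ a : code '' S, ∃ x ∈ S, code x = a := fun a => a.2
  choose rep hrepS hrep using hrep
  have : Fintype (code '' S) := hfin.fintype
  refine ⟨Finset.univ.image rep, ?_, fun y hy => ?_, ?_⟩
  · simp only [Finset.mem_image, Finset.mem_univ, true_and]
    rintro _ ⟨a, rfl⟩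
    exact hrepS a
  · exact ⟨rep ⟨code y, y, hy, rfl⟩, Finset.mem_image_of_mem _ (Finset.mem_univ _),
      hB _ (hrepS _) _ hy (hrep _)⟩
  · refine Finset.card_image_le.trans ?_
    rw [Finset.card_univ, ← Set.toFinset_card]
    refine Finset.card_le_card fun a ha => ?_
    obtain ⟨x, hx, rfl⟩ := Set.mem_toFinset.1 ha
    exact hG x hx

/-- Some residue class modulo `m` carries at most the average of a nonnegative sum. -/
theorem exists_offset_sum_le {m J N : ℕ} (hm : 0 < m) (hJ : m * J ≤ N) (f : ℕ → ℝ)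
    (hf : ∀ i, 0 ≤ f i) {u : ℝ} (hu : ∑ i ∈ Finset.range N, f i ≤ u) :
    ∃ r : Fin m, ∑ j : Fin J, f (r + m * j) ≤ u / m := by
  by_contra! h
  have : Nonempty (Fin m) := ⟨⟨0, hm⟩⟩
  have hm' : (0 : ℝ) < m := by exact_mod_cast hm
  have h1 : u < ∑ r : Fin m, ∑ j : Fin J, f (r + m * j) := by
    calc u = ∑ _r : Fin m, u / m := by simp; field_simp
      _ < _ := Finset.sum_lt_sum_of_nonempty Finset.univ_nonempty fun r _ => h r
  have h2 : ∑ r : Fin m, ∑ j : Fin J, f (r + m * j) = ∑ i ∈ Finset.range (J * m), f i := by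
    rw [← Fin.sum_univ_eq_sum_range, ← finProdFinEquiv.sum_comp, Fintype.sum_prod_type,
      Finset.sum_comm]
    simp [finProdFinEquiv]
  have h3 : ∑ i ∈ Finset.range (J * m), f i ≤ ∑ i ∈ Finset.range N, f i :=
    Finset.sum_le_sum_of_subset_of_nonneg
      (Finset.range_mono (by rwa [mul_comm])) fun i _ _ => hf i
  linarith

/-- If the `m`-block costs along each orbit of length `N` starting in `S` are at most `s` on
average, then `S` is covered by about `exp (N * s / m)` Bowen balls. -/
theorem exists_bowen_cover {X : Type*} (D : X → X → ℝ) (T : X → X) {k m : ℕ} (P : X → Fin k)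
    {ε : ℝ} (hP : ∀ x y, P x = P y → D x y ≤ ε) (hm : 0 < m) (c : (Fin m → Fin k) → ℝ)
    (hc0 : ∀ a, 0 ≤ c a) (hc : ∑ a, Real.exp (-c a) ≤ 1) {N : ℕ} (hN : 2 * m ≤ N) (s : ℝ)
    (S : Set X)
    (hS : ∀ x ∈ S, ∑ i ∈ Finset.range N, c (fun j => P (T^[j] (T^[i] x))) ≤ N * s) :
    ∃ E : Finset X, (∀ x ∈ E, x ∈ S) ∧ (∀ y ∈ S, ∃ x ∈ E, y ∈ bowenBallD D T x N ε) ∧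
      (E.card : ℝ) ≤ (m * k ^ m * k ^ (2 * m) : ℕ) * Real.exp (N * s / m) := by
  classical
  set J := N / m - 1 with hJdef
  have hdiv : m * (N / m) + N % m = N := Nat.div_add_mod N m
  have hmod : N % m < m := Nat.mod_lt N hm
  have h2 : 2 ≤ N / m := (Nat.le_div_iff_mul_le hm).2 hN
  have hJm : m * J + m = m * (N / m) := by
    rw [← Nat.mul_succ, Nat.succ_eq_add_one, hJdef, Nat.sub_add_cancel (by omega)]
  have hoff : ∀ x : X, ∃ r : Fin m, x ∈ S →
      ∑ j : Fin J, c (fun l => P (T^[l] (T^[r + m * j] x))) ≤ N * s / m := by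
    intro x
    by_cases hx : x ∈ S
    · obtain ⟨r, hr⟩ := exists_offset_sum_le (m := m) (J := J) (N := N) hm (by omega)
        (fun i => c (fun l => P (T^[l] (T^[i] x)))) (fun i => hc0 _) (hS x hx)
      exact ⟨r, fun _ => hr⟩
    · exact ⟨⟨0, hm⟩, fun h => absurd h hx⟩
  choose r hr using hoff
  let code : X → Fin m × (Fin m → Fin k) × (Fin (2 * m) → Fin k) × (Fin J → Fin m → Fin k) :=
    fun x => (r x, fun i => P (T^[i] x), fun i => P (T^[N - 2 * m + i] x),
      fun j l => P (T^[l] (T^[r x + m * j] x)))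
  obtain ⟨E, hE, hcov, hcard⟩ := exists_finset_cover_of_code S (fun x => bowenBallD D T x N ε) code
    (Finset.univ ×ˢ Finset.univ ×ˢ Finset.univ ×ˢ
      (Finset.univ.filter fun b : Fin J → Fin m → Fin k => ∑ j, c (b j) ≤ N * s / m))
    (fun x hx => by simpa [code] using hr x hx) (fun x _ y _ hxy i hi => by
      simp only [code, Prod.mk.injEq] at hxy
      obtain ⟨h1, h3, h4, h5⟩ := hxy
      apply hP
      have hrx := (r x).2
      rcases lt_or_ge i m with him | him
      · exact congrFun h3 ⟨i, him⟩
      rcases le_or_gt (N - 2 * m) i with hi2 | hi2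
      · have := congrFun h4 ⟨i - (N - 2 * m), by omega⟩
        simpa [Nat.add_sub_cancel' hi2] using this
      · have hsplit : m * ((i - r x) / m) + (i - r x) % m = i - r x := Nat.div_add_mod _ _
        have hlt : (i - r x) / m < J := by
          rw [Nat.div_lt_iff_lt_mul hm, mul_comm]
          omega
        have := congrFun (congrFun h5 ⟨(i - r x) / m, hlt⟩) ⟨(i - r x) % m, Nat.mod_lt _ hm⟩
        simp only [← Function.iterate_add_apply, ← h1] at this
        have hi' : (i - r x) % m + (r x + m * ((i - r x) / m)) = i := by omega
        rwa [hi'] at this)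
  refine ⟨E, hE, hcov, ?_⟩
  calc (E.card : ℝ) ≤ _ := Nat.cast_le.2 hcard
    _ = (m * k ^ m * k ^ (2 * m) : ℕ) *
        ((Finset.univ.filter fun b : Fin J → Fin m → Fin k =>
          ∑ j, c (b j) ≤ N * s / m).card : ℝ) := by
      simp only [Finset.card_product, Finset.card_univ, Fintype.card_fin, Fintype.card_fun]
      push_cast
      ring
    _ ≤ _ := mul_le_mul_of_nonneg_left (card_filter_sum_le c hc J _) (Nat.cast_nonneg _)

/-- Integration against an empirical measure is a Birkhoff average. -/
theorem integral_empPM {X : Type*} [MeasurableSpace X] [MeasurableSingletonClass X] (T : X → X)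
    (f : X → ℝ) (x : X) (n : ℕ) :
    ∫ z, f z ∂(empPM T x n : Measure X)
      = ((n + 1 : ℕ) : ℝ)⁻¹ * ∑ i ∈ Finset.range (n + 1), f (T^[i] x) := by
  have h : ((empPM T x n : ProbabilityMeasure X) : Measure X)
      = ((n + 1 : ℝ≥0∞))⁻¹ • ∑ k ∈ Finset.range (n + 1), Measure.dirac (T^[k] x) := rfl
  rw [h, integral_smul_measure, integral_finsetSum_measure]
  · simp only [integral_dirac, smul_eq_mul, ENNReal.toReal_inv]
    congr 2
    rw [show ((n : ℝ≥0∞) + 1) = ((n + 1 : ℕ) : ℝ≥0∞) by push_cast; rfl, ENNReal.toReal_natCast]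
  · exact fun i _ => integrable_dirac (by simp)

/-- Limits of empirical measures along the orbit of a point are invariant. -/
theorem invMeas_of_tendsto_empPM {X : Type*} [MetricSpace X] [CompactSpace X] [MeasurableSpace X]
    [BorelSpace X] {T : X → X} (hT : Continuous T) {x : X} {l : Filter ℕ} [l.NeBot]
    (hl : l ≤ atTop) {μ : ProbabilityMeasure X} (h : Tendsto (empPM T x) l (𝓝 μ)) :
    InvMeas T μ := by
  have : IsProbabilityMeasure ((μ : Measure X).map T) :=
    Measure.isProbabilityMeasure_map hT.measurable.aemeasurable
  refine ext_of_forall_integral_eq_of_IsFiniteMeasure fun f => ?_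
  rw [integral_map hT.measurable.aemeasurable f.continuous.aestronglyMeasurable]
  have hlim := ProbabilityMeasure.tendsto_iff_forall_integral_tendsto.1 h
  have h1 := (hlim (f.compContinuous ⟨T, hT⟩)).sub (hlim f)
  have h2 : Tendsto (fun n : ℕ => ((n + 1 : ℕ) : ℝ)⁻¹ * (f (T^[n + 1] x) - f x)) l (𝓝 0) := by
    have h0 : Tendsto (fun n : ℕ => ((n + 1 : ℕ) : ℝ)⁻¹) atTop (𝓝 0) :=
      (tendsto_inv_atTop_nhds_zero_nat (𝕜 := ℝ)).comp (tendsto_add_atTop_nat 1)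
    refine (h0.mono_left hl).zero_mul_isBoundedUnder_le ?_
    refine isBoundedUnder_of ⟨2 * ‖f‖, fun n => ?_⟩
    exact (dist_eq_norm _ _).symm.trans_le (f.dist_le_two_norm _ _)
  refine sub_eq_zero.1 (tendsto_nhds_unique (h1.congr fun n => ?_) h2)
  rw [integral_empPM, integral_empPM, ← mul_sub, ← Finset.sum_sub_distrib]
  simp only [BoundedContinuousFunction.compContinuous_apply, ContinuousMap.coe_mk,
    ← Function.iterate_succ_apply' T]
  rw [Finset.sum_range_sub fun i => f (T^[i] x)]
  rfl

theorem isClosed_setOf_invMeas {X : Type*} [MetricSpace X] [MeasurableSpace X]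
    [BorelSpace X] {T : X → X} (hT : Continuous T) :
    IsClosed {μ : ProbabilityMeasure X | InvMeas T μ} := by
  have h : {μ : ProbabilityMeasure X | InvMeas T μ}
      = {μ | μ.map hT.measurable.aemeasurable = μ} := by
    ext μ
    exact ⟨fun h => Subtype.ext h, fun h => congrArg Subtype.val h⟩
  rw [h]
  exact isClosed_eq (ProbabilityMeasure.continuous_map hT) continuous_id

/-- Every compact metric space has finite measurable partitions of small mesh whose boundary is
negligible. -/
theorem exists_partition_ae_continuousAt {X : Type*} [MetricSpace X] [CompactSpace X]
    [MeasurableSpace X] [BorelSpace X] (μ : Measure X) [IsFiniteMeasure μ] {ε : ℝ} (hε : 0 < ε) :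
    ∃ (k : ℕ) (P : X → Fin k), Measurable P ∧ (∀ x y, P x = P y → dist x y ≤ ε) ∧
      ∀ᵐ x ∂μ, ContinuousAt P x := by
  classical
  have hr : ∀ x : X, ∃ r ∈ Ioo (0 : ℝ) (ε / 2), μ (frontier (Metric.thickening r {x})) = 0 :=
    fun x => exists_null_frontier_thickening μ {x} (half_pos hε)
  choose r hr hfr using hr
  simp only [Metric.thickening_singleton] at hfr
  obtain ⟨t, ht⟩ := CompactSpace.elim_nhds_subcover (fun x => Metric.ball x (r x))
    fun x => Metric.ball_mem_nhds x (hr x).1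
  let Q : X → t → Bool := fun x i => decide (x ∈ Metric.ball (i : X) (r i))
  let e : (t → Bool) ≃ Fin (Fintype.card (t → Bool)) := Fintype.equivFin _
  refine ⟨_, fun x => e (Q x), ?_, fun x y hxy => ?_, ?_⟩
  · refine (measurable_of_finite e).comp (measurable_pi_iff.2 fun i => ?_)
    refine measurable_to_bool ?_
    convert! (Metric.isOpen_ball (x := (i : X)) (ε := r i)).measurableSet using 1
    ext z
    simp [Q]
  · have hQ : Q x = Q y := e.injective hxy
    have hx : x ∈ ⋃ z ∈ t, Metric.ball z (r z) := ht ▸ mem_univ x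
    simp only [mem_iUnion, exists_prop] at hx
    obtain ⟨z, hz, hxz⟩ := hx
    have hyz : y ∈ Metric.ball z (r z) := by
      have := congrFun hQ ⟨z, hz⟩
      simp only [Q, decide_eq_decide] at this
      exact this.1 hxz
    have h1 := Metric.mem_ball.1 hxz
    have h2 := Metric.mem_ball'.1 hyz
    linarith [dist_triangle x z y, (hr z).2]
  · have hae : ∀ᵐ x ∂μ, ∀ i : t, x ∉ frontier (Metric.ball (i : X) (r i)) :=
      ae_all_iff.2 fun i => measure_eq_zero_iff_ae_notMem.1 (hfr i)
    filter_upwards [hae] with x hx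
    refine (continuous_of_discreteTopology (f := e)).continuousAt.comp
      (continuousAt_pi.2 fun i => ?_)
    by_cases hxi : x ∈ Metric.ball (i : X) (r i)
    · refine (continuousAt_const (y := true)).congr ?_
      filter_upwards [Metric.isOpen_ball.mem_nhds hxi] with z hz
      simpa [Q] using hz
    · have hxc : x ∉ closure (Metric.ball (i : X) (r i)) := fun h =>
        hx i ⟨h, by rwa [Metric.isOpen_ball.interior_eq]⟩
      refine (continuousAt_const (y := false)).congr ?_
      filter_upwards [isClosed_closure.isOpen_compl.mem_nhds hxc] with z hz
      simpa [Q] using fun h => hz (subset_closure h)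

/-- Integrals of functions of an almost everywhere continuous finite-valued map are continuous in
the measure. -/
theorem tendsto_integral_comp_of_ae_continuousAt {X α : Type*} [MetricSpace X]
    [MeasurableSpace X] [BorelSpace X] [Fintype α] [TopologicalSpace α] [DiscreteTopology α]
    [MeasurableSpace α] [MeasurableSingletonClass α] {μ : ProbabilityMeasure X} {B : X → α}
    (hB : Measurable B) (hBc : ∀ᵐ x ∂(μ : Measure X), ContinuousAt B x) (c : α → ℝ) :
    Tendsto (fun ν : ProbabilityMeasure X => ∫ x, c (B x) ∂(ν : Measure X)) (𝓝 μ)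
      (𝓝 (∫ x, c (B x) ∂(μ : Measure X))) := by
  have hsum : ∀ ν : ProbabilityMeasure X, ∫ x, c (B x) ∂(ν : Measure X)
      = ∑ a, ((ν : Measure X) (B ⁻¹' {a})).toReal * c a := by
    intro ν
    have : IsProbabilityMeasure ((ν : Measure X).map B) :=
      Measure.isProbabilityMeasure_map hB.aemeasurable
    rw [← integral_map hB.aemeasurable
      (StronglyMeasurable.of_discrete (f := c)).aestronglyMeasurable,
      integral_fintype Integrable.of_finite]
    refine Finset.sum_congr rfl fun a _ => ?_
    rw [Measure.real, Measure.map_apply hB (measurableSet_singleton a), smul_eq_mul]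
  simp only [hsum]
  refine tendsto_finsetSum _ fun a _ => Tendsto.mul_const _ ?_
  have hnull : (μ : Measure X) (frontier (B ⁻¹' {a})) = 0 := by
    refine measure_mono_null (fun x hx => ?_) (ae_iff.1 hBc)
    intro hcont
    by_cases hxa : B x = a
    · have : B ⁻¹' {a} ∈ 𝓝 x := hcont ((isOpen_discrete {a}).mem_nhds hxa)
      exact hx.2 (mem_interior_iff_mem_nhds.2 this)
    · have : B ⁻¹' {a}ᶜ ∈ 𝓝 x := hcont ((isOpen_discrete {a}ᶜ).mem_nhds hxa)
      rw [preimage_compl, ← mem_interior_iff_mem_nhds, interior_compl] at this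
      exact this hx.1
  exact (ENNReal.tendsto_toReal (measure_ne_top _ _)).comp
    (ProbabilityMeasure.tendsto_measure_of_null_frontier_of_tendsto' tendsto_id hnull)

/-- The block map of an almost everywhere continuous partition is almost everywhere continuous
with respect to an invariant measure. -/
theorem ae_continuousAt_block {X : Type*} [TopologicalSpace X] [MeasurableSpace X] [BorelSpace X]
    {T : X → X} (hT : Continuous T) {μ : ProbabilityMeasure X} (hμ : InvMeas T μ) {k : ℕ}
    {P : X → Fin k} (hP : ∀ᵐ x ∂(μ : Measure X), ContinuousAt P x) (m : ℕ) :
    ∀ᵐ x ∂(μ : Measure X), ContinuousAt (fun y (j : Fin m) => P (T^[j] y)) x := by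
  have hmp : MeasurePreserving T (μ : Measure X) (μ : Measure X) := ⟨hT.measurable, hμ⟩
  have : ∀ᵐ x ∂(μ : Measure X), ∀ j : Fin m, ContinuousAt P (T^[j] x) :=
    ae_all_iff.2 fun j => (hmp.iterate j).quasiMeasurePreserving.ae hP
  filter_upwards [this] with x hx
  exact continuousAt_pi.2 fun j =>
    ContinuousAt.comp (f := fun y => T^[j] y) (hx j) (hT.iterate j).continuousAt

/-- The weighted number of Bowen balls needed to cover the points whose `n`-th empirical measure
lies in `U` decays exponentially. -/
def CoverDecay {X : Type*} [MetricSpace X] [MeasurableSpace X] (T : X → X) (φ : X → ℝ)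
    (t ε δ : ℝ) (U : Set (ProbabilityMeasure X)) : Prop :=
  ∃ (C : ℝ) (N₀ : ℕ), ∀ n ≥ N₀, ∃ E : Finset X,
    (∀ x, empPM T x n ∈ U → ∃ p ∈ E, x ∈ bowenBallD (fun a b => dist a b) T p (n + 1) ε) ∧
    ∑ p ∈ E, Real.exp (-t * ((n + 1 : ℕ) : ℝ) +
      sSup (birkhoffS T φ (n + 1) '' bowenBallD (fun a b => dist a b) T p (n + 1) ε))
      ≤ C * Real.exp (-δ) ^ (n + 1)

theorem CoverDecay.union {X : Type*} [MetricSpace X] [MeasurableSpace X] {T : X → X} {φ : X → ℝ}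
    {t ε δ : ℝ} {U V : Set (ProbabilityMeasure X)} (hU : CoverDecay T φ t ε δ U)
    (hV : CoverDecay T φ t ε δ V) : CoverDecay T φ t ε δ (U ∪ V) := by
  classical
  obtain ⟨C, N, h⟩ := hU
  obtain ⟨C', N', h'⟩ := hV
  refine ⟨C + C', max N N', fun n hn => ?_⟩
  obtain ⟨E, hE, hs⟩ := h n (le_of_max_le_left hn)
  obtain ⟨E', hE', hs'⟩ := h' n (le_of_max_le_right hn)
  refine ⟨E ∪ E', fun x hx => ?_, ?_⟩
  · rcases hx with hx | hx
    · obtain ⟨p, hp, hxp⟩ := hE x hx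
      exact ⟨p, Finset.mem_union_left _ hp, hxp⟩
    · obtain ⟨p, hp, hxp⟩ := hE' x hx
      exact ⟨p, Finset.mem_union_right _ hp, hxp⟩
  · rw [add_mul]
    refine le_trans ?_ (add_le_add hs hs')
    rw [← Finset.sum_union_inter]
    exact le_add_of_nonneg_right (Finset.sum_nonneg fun _ _ => (Real.exp_pos _).le)

theorem sSup_birkhoffS_bowenBall_le {X : Type*} [MetricSpace X] {T : X → X} {φ : X → ℝ}
    {ε γ : ℝ} (hε : 0 ≤ ε) (hγ : ∀ x y, dist x y ≤ ε → |φ x - φ y| ≤ γ) (p : X) (n : ℕ) :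
    sSup (birkhoffS T φ n '' bowenBallD (fun a b => dist a b) T p n ε)
      ≤ birkhoffS T φ n p + n * γ := by
  refine csSup_le (Set.Nonempty.image _ ⟨p, fun i _ => by simpa using hε⟩) ?_
  rintro _ ⟨y, hy, rfl⟩
  have : birkhoffS T φ n y ≤ ∑ i ∈ Finset.range n, (φ (T^[i] p) + γ) :=
    Finset.sum_le_sum fun i hi => by
      linarith [(abs_le.1 (hγ _ _ (hy i (Finset.mem_range.1 hi)))).1]
  simpa [birkhoffS, Finset.sum_add_distrib] using this

/-- The block entropy of a fine partition is dominated by the metric entropy. -/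
theorem exists_partitionH_lt {X : Type*} [MeasurableSpace X] {T : X → X} {μ : Measure X}
    {I t : ℝ} (h : ((entropyKS T μ : ℝ≥0∞) : EReal) + (I : EReal) < (t : EReal)) {k : ℕ}
    {P : X → Fin k} (hP : Measurable P) :
    ∃ n : ℕ, partitionH T μ P (n + 1) / ((n + 1 : ℕ) : ℝ) + I < t := by
  have h1 : entropyKS T μ < ENNReal.ofReal (t - I) := by
    by_contra! hle
    have h2 : ((t - I : ℝ) : EReal) ≤ (entropyKS T μ : EReal) :=
      calc ((t - I : ℝ) : EReal) ≤ ((ENNReal.ofReal (t - I) : ℝ≥0∞) : EReal) := by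
            rw [EReal.coe_ennreal_ofReal]
            exact_mod_cast le_max_left _ _
        _ ≤ _ := EReal.coe_ennreal_le_coe_ennreal_iff.2 hle
    have h3 : (t : EReal) ≤ (entropyKS T μ : EReal) + (I : EReal) :=
      calc (t : EReal) = ((t - I : ℝ) : EReal) + (I : EReal) := by
            rw [← EReal.coe_add, sub_add_cancel]
        _ ≤ _ := add_le_add_left h2 _
    exact absurd h (not_lt.2 h3)
  have h2 : ⨅ n : ℕ, ENNReal.ofReal (partitionH T μ P (n + 1) / (n + 1)) ≤ entropyKS T μ :=
    le_iSup_of_le k (le_iSup_of_le P (le_iSup_of_le hP le_rfl))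
  obtain ⟨n, hn⟩ := iInf_lt_iff.1 (h2.trans_lt h1)
  refine ⟨n, ?_⟩
  have := (ENNReal.ofReal_lt_ofReal_iff'.1 hn).1
  push_cast
  linarith

/-- An invariant measure of free energy below `t` has a neighbourhood with exponentially decaying
covering sums. -/
theorem exists_isOpen_coverDecay {X : Type*} [MetricSpace X] [CompactSpace X] [MeasurableSpace X]
    [BorelSpace X] {T : X → X} (hT : Continuous T) {φ : X → ℝ} (hφ : Continuous φ)
    {μ : ProbabilityMeasure X} (hμ : InvMeas T μ) {t₀ ε δ : ℝ} (hε : 0 < ε) (hδ : 0 < δ)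
    (hγ : ∀ x y, dist x y ≤ ε → |φ x - φ y| ≤ δ)
    (h : ((entropyKS T (μ : Measure X) : ℝ≥0∞) : EReal) +
      ((∫ x, φ x ∂(μ : Measure X) : ℝ) : EReal) < (t₀ : EReal)) :
    ∃ U : Set (ProbabilityMeasure X), IsOpen U ∧ μ ∈ U ∧ CoverDecay T φ (t₀ + 5 * δ) ε δ U := by
  obtain ⟨k, P, hPm, hPε, hPc⟩ := exists_partition_ae_continuousAt (μ : Measure X) hε
  obtain ⟨m', hent⟩ := exists_partitionH_lt h hPm
  set m := m' + 1 with hm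
  have hm0 : 0 < m := Nat.succ_pos _
  let B : X → Fin m → Fin k := fun x j => P (T^[j] x)
  have hBm : Measurable B :=
    measurable_pi_iff.2 fun j => hPm.comp (hT.iterate j).measurable
  have hBc : ∀ᵐ x ∂(μ : Measure X), ContinuousAt B x := ae_continuousAt_block hT hμ hPc m
  let q : (Fin m → Fin k) → ℝ := fun a => ((μ : Measure X) (B ⁻¹' {a})).toReal
  have hμB : IsProbabilityMeasure ((μ : Measure X).map B) :=
    Measure.isProbabilityMeasure_map hBm.aemeasurable
  have hq : ∀ a, q a = ((μ : Measure X).map B).real {a} := fun a => by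
    rw [Measure.real, Measure.map_apply hBm (measurableSet_singleton a)]
  have hq1 : ∑ a, q a = 1 := by
    simp only [hq]
    rw [sum_measureReal_singleton]
    simp
  obtain ⟨c, hc0, hc1, hc⟩ := exists_cost_le_entropy_add q (fun a => ENNReal.toReal_nonneg) hq1 hδ
  have hH : ∑ a, Real.negMulLog (q a) = partitionH T (μ : Measure X) P m := by
    refine Finset.sum_congr rfl fun a _ => ?_
    have hset : B ⁻¹' {a} = {x | ∀ j : Fin m, P (T^[(j : ℕ)] x) = a j} := by
      ext x
      simp [B, funext_iff]
    simp only [q, hset]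
  have hcint : ∫ x, c (B x) ∂(μ : Measure X) ≤ partitionH T (μ : Measure X) P m + δ := by
    rw [← integral_map hBm.aemeasurable
      (StronglyMeasurable.of_discrete (f := c)).aestronglyMeasurable,
      integral_fintype Integrable.of_finite, ← hH]
    simpa only [← hq, smul_eq_mul] using hc
  have hev1 := (tendsto_integral_comp_of_ae_continuousAt hBm hBc c).eventually_lt_const
    (lt_add_of_pos_right _ hδ)
  have hev2 := (ProbabilityMeasure.tendsto_iff_forall_integral_tendsto.1 (tendsto_id (x := 𝓝 μ))
    (BoundedContinuousFunction.mkOfCompact ⟨φ, hφ⟩)).eventually_lt_const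
    (lt_add_of_pos_right _ hδ)
  obtain ⟨U, hU, hUo, hμU⟩ := eventually_nhds_iff.1 (hev1.and hev2)
  refine ⟨U, hUo, hμU, (m * k ^ m * k ^ (2 * m) : ℕ), 2 * m, fun n hn => ?_⟩
  have hn0 : (0 : ℝ) < ((n + 1 : ℕ) : ℝ) := by positivity
  have hm0' : (0 : ℝ) < (m : ℝ) := by exact_mod_cast hm0
  set H := partitionH T (μ : Measure X) P m with hHdef
  obtain ⟨E, hES, hcov, hcard⟩ := exists_bowen_cover (fun a b => dist a b) T P hPε hm0 c hc0 hc1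
    (N := n + 1) (by omega) (H + 2 * δ) {x | empPM T x n ∈ U} (fun x hx => by
      have h1 := (hU _ hx).1
      rw [integral_empPM, inv_mul_lt_iff₀ hn0] at h1
      refine h1.le.trans (mul_le_mul_of_nonneg_left ?_ hn0.le)
      linarith)
  refine ⟨E, hcov, ?_⟩
  have hsup : ∀ p ∈ E, sSup (birkhoffS T φ (n + 1) ''
      bowenBallD (fun a b => dist a b) T p (n + 1) ε)
      ≤ ((n + 1 : ℕ) : ℝ) * (∫ x, φ x ∂(μ : Measure X) + 2 * δ) := by
    intro p hp
    have h1 := (hU _ (hES p hp)).2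
    simp only [id, BoundedContinuousFunction.mkOfCompact_apply, ContinuousMap.coe_mk] at h1
    rw [integral_empPM, inv_mul_lt_iff₀ hn0] at h1
    have h2 := sSup_birkhoffS_bowenBall_le (T := T) hε.le hγ p (n + 1)
    simp only [birkhoffS] at h2 ⊢
    linarith
  set N : ℝ := ((n + 1 : ℕ) : ℝ) with hN
  calc _ ≤ ∑ p ∈ E, Real.exp (-(t₀ + 5 * δ) * N + N * (∫ x, φ x ∂(μ : Measure X) + 2 * δ)) :=
        Finset.sum_le_sum fun p hp => Real.exp_le_exp.2 (add_le_add_right (hsup p hp) _)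
    _ = E.card * Real.exp (-(t₀ + 5 * δ) * N + N * (∫ x, φ x ∂(μ : Measure X) + 2 * δ)) := by
        rw [Finset.sum_const, nsmul_eq_mul]
    _ ≤ (m * k ^ m * k ^ (2 * m) : ℕ) * Real.exp (N * (H + 2 * δ) / m) *
          Real.exp (-(t₀ + 5 * δ) * N + N * (∫ x, φ x ∂(μ : Measure X) + 2 * δ)) :=
        mul_le_mul_of_nonneg_right hcard (Real.exp_pos _).le
    _ ≤ (m * k ^ m * k ^ (2 * m) : ℕ) * Real.exp (-δ) ^ (n + 1) := by
        rw [mul_assoc, ← Real.exp_add, ← Real.exp_nat_mul]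
        refine mul_le_mul_of_nonneg_left (Real.exp_le_exp.2 ?_) (Nat.cast_nonneg _)
        have h1 : (H + 2 * δ) / m ≤ H / m + 2 * δ := by
          rw [add_div]
          have : 2 * δ / m ≤ 2 * δ :=
            div_le_self (by linarith) (by exact_mod_cast hm0)
          linarith
        have h2 : N * ((H + 2 * δ) / m) ≤ N * (H / m + 2 * δ) :=
          mul_le_mul_of_nonneg_left h1 hn0.le
        have h3 := mul_le_mul_of_nonneg_left hent.le hn0.le
        rw [mul_div_assoc]
        linarith

/-- A compact set of measures that are covered locally with exponential decay has a neighbourhood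
with this property. -/
theorem exists_nhdsSet_coverDecay {X : Type*} [MetricSpace X] [MeasurableSpace X] [BorelSpace X]
    {T : X → X} {φ : X → ℝ} {t ε δ : ℝ} {F : Set (ProbabilityMeasure X)} (hF : IsCompact F)
    (h : ∀ μ ∈ F, ∃ U, IsOpen U ∧ μ ∈ U ∧ CoverDecay T φ t ε δ U) :
    ∃ U ∈ 𝓝ˢ F, CoverDecay T φ t ε δ U := by
  refine hF.induction_on (p := fun F => ∃ U ∈ 𝓝ˢ F, CoverDecay T φ t ε δ U) ?_ ?_ ?_ ?_
  · exact ⟨∅, by simp, 0, 0, fun n _ => ⟨∅, by simp, by simp⟩⟩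
  · rintro s s' hs ⟨U, hU, hd⟩
    exact ⟨U, nhdsSet_mono hs hU, hd⟩
  · rintro s s' ⟨U, hU, hd⟩ ⟨V, hV, hd'⟩
    exact ⟨U ∪ V, union_mem_nhdsSet hU hV, hd.union hd'⟩
  · intro μ hμ
    obtain ⟨U, hUo, hμU, hd⟩ := h μ hμ
    exact ⟨U, mem_nhdsWithin_of_mem_nhds (hUo.mem_nhds hμU), U, hUo.mem_nhdsSet_self, hd⟩

/-- Points whose empirical measures visit `U` infinitely often have small pressure. -/
theorem CoverDecay.pressAt_le {X : Type*} [MetricSpace X] [MeasurableSpace X] {T : X → X}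
    {φ : X → ℝ} {t ε δ : ℝ} (hδ : 0 < δ) {U : Set (ProbabilityMeasure X)}
    (hU : CoverDecay T φ t ε δ U) {Z : Set X} (hZ : ∀ x ∈ Z, ∃ᶠ n in atTop, empPM T x n ∈ U) :
    pressAt (fun a b => dist a b) T Z φ ε ≤ (t : EReal) := by
  obtain ⟨C, N₀, h⟩ := hU
  refine sInf_le ⟨t, rfl, ?_⟩
  have hE : ∀ n, ∃ E : Finset X, N₀ ≤ n →
      (∀ x, empPM T x n ∈ U → ∃ p ∈ E, x ∈ bowenBallD (fun a b => dist a b) T p (n + 1) ε) ∧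
      ∑ p ∈ E, Real.exp (-t * ((n + 1 : ℕ) : ℝ) +
        sSup (birkhoffS T φ (n + 1) '' bowenBallD (fun a b => dist a b) T p (n + 1) ε))
        ≤ C * Real.exp (-δ) ^ (n + 1) := fun n => by
    by_cases hn : N₀ ≤ n
    · obtain ⟨E, hE⟩ := h n hn
      exact ⟨E, fun _ => hE⟩
    · exact ⟨∅, fun h => absurd h hn⟩
  choose E hE using hE
  have hsum : Summable fun n : ℕ => C * Real.exp (-δ) ^ (n + 1) :=
    ((summable_nat_add_iff 1).2 (summable_geometric_of_lt_one (Real.exp_pos _).le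
      (by simpa using hδ))).mul_left C
  have htail := ENNReal.tendsto_sum_nat_add
    (fun n : ℕ => ENNReal.ofReal (C * Real.exp (-δ) ^ (n + 1))) hsum.tsum_ofReal_ne_top
  rw [Mlim, ENNReal.iSup_eq_zero]
  intro n₁
  refine le_antisymm (ge_of_tendsto htail ?_) zero_le
  filter_upwards [eventually_ge_atTop (max n₁ N₀)] with n₂ hn₂
  let A : ℕ → Set (X × ℕ) := fun n => (fun p => (p, n + n₂ + 1)) '' (E (n + n₂) : Set X)
  let w : X × ℕ → ℝ≥0∞ := fun p => ENNReal.ofReal (Real.exp (-t * (p.2 : ℝ) +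
    sSup (birkhoffS T φ p.2 '' bowenBallD (fun a b => dist a b) T p.1 p.2 ε)))
  have hcov : covOK (fun a b => dist a b) T Z n₁ ε (⋃ n, A n) := by
    refine ⟨countable_iUnion fun n => ((E _).finite_toSet.image _).countable, ?_, fun x hx => ?_⟩
    · intro p hp
      obtain ⟨n, q, _, rfl⟩ := mem_iUnion.1 hp
      have := le_of_max_le_left hn₂
      simp only
      omega
    · obtain ⟨n, hn, hxn⟩ := frequently_atTop.1 (hZ x hx) n₂
      obtain ⟨p, hp, hxp⟩ := (hE n ((le_of_max_le_right hn₂).trans hn)).1 x hxn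
      refine mem_biUnion (x := (p, n + 1)) (mem_iUnion.2 ⟨n - n₂, ?_⟩) hxp
      refine ⟨p, ?_, ?_⟩ <;> simp only [Nat.sub_add_cancel hn]
      exact hp
  refine (iInf₂_le _ hcov).trans
    ((ENNReal.tsum_iUnion_le_tsum w A).trans (ENNReal.tsum_le_tsum fun n => ?_))
  rw [tsum_image w (Prod.mk_left_injective _).injOn]
  refine (Finset.tsum_subtype (E (n + n₂)) fun p => w (p, n + n₂ + 1)).trans_le ?_
  rw [← ENNReal.ofReal_sum_of_nonneg]
  · exact ENNReal.ofReal_le_ofReal (hE _ (by have := le_of_max_le_right hn₂; omega)).2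
  · exact fun _ _ => (Real.exp_pos _).le

theorem frequently_empPM_mem_of_mapClusterPt {X Y : Type*} [MetricSpace X] [CompactSpace X]
    [MeasurableSpace X] [BorelSpace X] [MetricSpace Y] {T : X → X} (hT : Continuous T)
    {Ξ : ProbabilityMeasure X → Y} (hΞ : Continuous Ξ) {x : X} {y : Y}
    (h : MapClusterPt y atTop fun n => Ξ (empPM T x n)) {U : Set (ProbabilityMeasure X)}
    (hU : U ∈ 𝓝ˢ {μ | InvMeas T μ ∧ Ξ μ = y}) : ∃ᶠ n in atTop, empPM T x n ∈ U := by
  obtain ⟨l, hl, hly⟩ := mapClusterPt_iff_ultrafilter.1 h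
  obtain ⟨μ, -, hμ⟩ := isCompact_univ.ultrafilter_le_nhds (l.map (empPM T x)) (by simp)
  have hμ' : Tendsto (empPM T x) l (𝓝 μ) := hμ
  have hF : μ ∈ {μ | InvMeas T μ ∧ Ξ μ = y} :=
    ⟨invMeas_of_tendsto_empPM hT hl hμ',
      tendsto_nhds_unique ((hΞ.tendsto μ).comp hμ') hly⟩
  exact ((hμ'.eventually (mem_nhdsSet_iff_forall.1 hU μ hF)).frequently).filter_mono hl

/-- If `K' ⊆ Y` is nonempty and closed and `Ξ : M(X) → Y` is continuous, then for
`G*_{K'} = {x : A(Ξ L_n x) = K'}`, `P(G*_{K'}, φ) ≤ inf_{y ∈ K'} Λ(y,φ)`. -/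
theorem pressure_Gstar_le_inf_Lam
    {X Y : Type*} [MetricSpace X] [CompactSpace X] [MeasurableSpace X] [BorelSpace X]
    [MetricSpace Y]
    (T : X → X) (hT : Continuous T) (φ : X → ℝ) (hφ : Continuous φ)
    (Ξ : ProbabilityMeasure X → Y) (hΞ : Continuous Ξ)
    (K' : Set Y) (hK'ne : K'.Nonempty) (hK'cl : IsClosed K') :
    pressure T {x : X | (accPts fun n => Ξ (empPM T x n)) = K'} φ ≤
      ⨅ y ∈ K', Lam T Ξ φ y := by
  refine le_iInf₂ fun y hy => EReal.le_of_forall_lt_iff_le.1 fun t ht => ?_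
  obtain ⟨t₀, ht₀, ht₀t⟩ := EReal.lt_iff_exists_real_btwn.1 ht
  rw [EReal.coe_lt_coe_iff] at ht₀t
  obtain ⟨δ, hδ, rfl⟩ : ∃ δ > 0, t = t₀ + 5 * δ := ⟨(t - t₀) / 5, by linarith, by ring⟩
  obtain ⟨ε₀, hε₀, hunif⟩ := Metric.uniformContinuous_iff.1
    (CompactSpace.uniformContinuous_of_continuous hφ) δ hδ
  refine limsup_le_of_le (h := ?_)
  filter_upwards [Ioo_mem_nhdsGT hε₀] with ε hε
  have hF : IsCompact {μ : ProbabilityMeasure X | InvMeas T μ ∧ Ξ μ = y} :=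
    ((isClosed_setOf_invMeas hT).inter (isClosed_singleton.preimage hΞ)).isCompact
  obtain ⟨U, hU, hdecay⟩ := exists_nhdsSet_coverDecay (T := T) (φ := φ) (t := t₀ + 5 * δ) (ε := ε)
    (δ := δ) hF fun μ hμ => exists_isOpen_coverDecay hT hφ hμ.1 hε.1 hδ
      (fun a b hab => (hunif (hab.trans_lt hε.2)).le)
      ((le_iSup₂_of_le μ hμ le_rfl).trans_lt ht₀)
  refine hdecay.pressAt_le hδ fun x hx => frequently_empPM_mem_of_mapClusterPt hT hΞ ?_ hU
  rw [← (show (accPts fun n => Ξ (empPM T x n)) = K' from hx)] at hy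
  exact hy
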